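/- arXiv:2302.03319 — 3 statements merged into one kernel-verified Lean document; each statement's English description precedes it below -/
import Mathlib

section
/- Let θ, ϑ ∈ ℝ^K, let β ≥ 0, and let j* be an index attaining max_j θ_j. Then the softmax probability of j* under ϑ satisfies exp(β ϑ_{j*}) / ∑_{j=1}^K exp(β ϑ_j) ≥ ( ∑_{j=1}^K exp( 2β ‖ϑ − θ‖_∞ − β (θ_{j*} − θ_j) ) )^{-1}, where ‖·‖_∞ denotes the supremum norm. -/
open Real

/-- For `θ, ϑ ∈ ℝ^K`, `β ≥ 0`, and `j*` attaining `max_j θ_j`, the softmax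
probability of `j*` under `ϑ` satisfies
`exp(β ϑ_{j*}) / ∑_j exp(β ϑ_j) ≥ (∑_j exp(2β‖ϑ−θ‖_∞ − β(θ_{j*} − θ_j)))⁻¹`,
where `‖·‖` is the sup-norm on `Fin K → ℝ`. -/
theorem softmax_optimal_arm_lower_bound
    (K : ℕ) (θ ϑ : Fin K → ℝ) (β : ℝ) (hβ : 0 ≤ β)
    (jstar : Fin K) (hjstar : ∀ j, θ j ≤ θ jstar) :
    (∑ j, Real.exp (2 * β * ‖ϑ - θ‖ - β * (θ jstar - θ j)))⁻¹
      ≤ Real.exp (β * ϑ jstar) / ∑ j, Real.exp (β * ϑ j) := by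
  have : Nonempty (Fin K) := ⟨jstar⟩
  rw [← inv_div, Finset.sum_div]
  refine inv_anti₀ (Finset.sum_pos (fun j _ => by positivity) Finset.univ_nonempty)
    (Finset.sum_le_sum fun j _ => ?_)
  rw [← Real.exp_sub, Real.exp_le_exp]
  have abs_sub_le (i : Fin K) : |ϑ i - θ i| ≤ ‖ϑ - θ‖ := norm_le_pi_norm (ϑ - θ) i
  have hj := (abs_le.mp (abs_sub_le j)).2
  have hstar := (abs_le.mp (abs_sub_le jstar)).1
  have hdiff : ϑ j - ϑ jstar ≤ 2 * ‖ϑ - θ‖ - (θ jstar - θ j) := by linarith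
  linarith [mul_le_mul_of_nonneg_left hdiff hβ]
end

section
/- Let θ, ϑ ∈ ℝ^K with ‖ϑ − θ‖_∞ ≤ δ for some δ ≥ 0, let β ≥ 0, let Δ ≥ 0, and let j* be an index attaining max_j θ_j. Then exp(β ϑ_{j*}) / ∑_{j=1}^K exp(β ϑ_j) ≥ exp(−2βδ) / ( |{ j : θ_{j*} − θ_j ≤ Δ }| + K exp(−βΔ) ). -/
open Real

/-- For `θ, ϑ ∈ ℝ^K` with `‖ϑ − θ‖_∞ ≤ δ` (`δ ≥ 0`), `β ≥ 0`, `Δ ≥ 0`,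
and `j*` attaining `max_j θ_j`, the softmax probability of `j*` under `ϑ` satisfies
`exp(β ϑ_{j*}) / ∑_j exp(β ϑ_j) ≥ exp(−2βδ) / (|{j : θ_{j*} − θ_j ≤ Δ}| + K exp(−βΔ))`. -/
theorem softmax_optimal_arm_near_optimal_count_bound
    (K : ℕ) (θ ϑ : Fin K → ℝ) (δ : ℝ) (hδ : 0 ≤ δ) (hnorm : ‖ϑ - θ‖ ≤ δ)
    (β Δ : ℝ) (hβ : 0 ≤ β) (hΔ : 0 ≤ Δ)
    (jstar : Fin K) (hjstar : ∀ j, θ j ≤ θ jstar) :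
    Real.exp (-(2 * β * δ)) /
        ((Nat.card {j : Fin K // θ jstar - θ j ≤ Δ} : ℝ) + K * Real.exp (-(β * Δ)))
      ≤ Real.exp (β * ϑ jstar) / ∑ j, Real.exp (β * ϑ j) := by
  classical
  have hcard : (Nat.card {j : Fin K // θ jstar - θ j ≤ Δ} : ℝ)
      = ∑ j, if θ jstar - θ j ≤ Δ then (1 : ℝ) else 0 := by
    rw [Nat.card_eq_fintype_card, Fintype.card_subtype, Finset.sum_boole]
  have hcoord (j : Fin K) : |ϑ j - θ j| ≤ δ := by
    simpa using (norm_le_pi_norm (ϑ - θ) j).trans hnorm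
  have hweight (j : Fin K) : Real.exp (β * ϑ j) ≤ Real.exp (β * ϑ jstar + 2 * β * δ) *
      ((if θ jstar - θ j ≤ Δ then (1 : ℝ) else 0) + Real.exp (-(β * Δ))) := by
    have hj := abs_le.mp (hcoord j)
    have hs := abs_le.mp (hcoord jstar)
    split_ifs with h
    · calc
        Real.exp (β * ϑ j) ≤ Real.exp (β * ϑ jstar + 2 * β * δ) := by
          apply Real.exp_le_exp.mpr
          have := mul_le_mul_of_nonneg_left
            (show ϑ j ≤ ϑ jstar + 2 * δ by linarith [hjstar j]) hβ
          linarith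
        _ ≤ _ := le_mul_of_one_le_right (Real.exp_pos _).le
          (by linarith [Real.exp_pos (-(β * Δ))])
    · rw [zero_add, ← Real.exp_add]
      apply Real.exp_le_exp.mpr
      have := mul_le_mul_of_nonneg_left
        (show ϑ j ≤ ϑ jstar + 2 * δ - Δ by linarith) hβ
      linarith
  have hsum : ∑ j, Real.exp (β * ϑ j) ≤ Real.exp (β * ϑ jstar + 2 * β * δ) *
      ((Nat.card {j : Fin K // θ jstar - θ j ≤ Δ} : ℝ) + K * Real.exp (-(β * Δ))) := by
    refine (Finset.sum_le_sum fun j _ => hweight j).trans_eq ?_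
    rw [← Finset.mul_sum, Finset.sum_add_distrib, hcard]
    simp
  have hK : (0 : ℝ) < K := by exact_mod_cast jstar.pos
  have hpos : 0 < ∑ j, Real.exp (β * ϑ j) :=
    Finset.sum_pos (fun j _ => Real.exp_pos _) ⟨jstar, Finset.mem_univ _⟩
  rw [div_le_div_iff₀ (by positivity) hpos]
  calc
    _ ≤ Real.exp (-(2 * β * δ)) * _ := mul_le_mul_of_nonneg_left hsum (Real.exp_pos _).le
    _ = _ := by
      rw [← mul_assoc, ← Real.exp_add]
      congr 2
      ring
end

section
/- Let K ≥ 1, Δ ≥ 0, and let θ_1, ..., θ_K be i.i.d. standard Gaussian random variables. Then the expected number of near-maximal coordinates satisfies E[ |{ k : θ_k ≥ max_{1≤j≤K} θ_j − Δ }| ] ≤ 1 + K Δ / √(2π). -/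
open MeasureTheory ProbabilityTheory Real

/-- The standard Gaussian density is at most `1 / √(2π)`, so an interval of length `Δ` has mass at
most `Δ / √(2π)`. -/
lemma gaussianReal_Icc_sub_le (m Δ : ℝ) :
    gaussianReal 0 1 (Set.Icc (m - Δ) m) ≤ ENNReal.ofReal (Δ / √(2 * π)) := by
  rw [gaussianReal_apply 0 one_ne_zero]
  calc ∫⁻ x in Set.Icc (m - Δ) m, gaussianPDF 0 1 x
      ≤ ∫⁻ _ in Set.Icc (m - Δ) m, ENNReal.ofReal (1 / √(2 * π)) := by
        refine lintegral_mono fun x => ENNReal.ofReal_le_ofReal ?_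
        rw [gaussianPDFReal, one_div]
        refine (mul_le_of_le_one_right (by positivity) (exp_le_one_iff.2 ?_)).trans (by simp)
        exact div_nonpos_of_nonpos_of_nonneg (by nlinarith [sq_nonneg (x - 0)]) (by positivity)
    _ = ENNReal.ofReal (Δ / √(2 * π)) := by
        rw [setLIntegral_const, Real.volume_Icc, ← ENNReal.ofReal_mul (by positivity)]
        congr 1
        ring

/-- The vectors whose `k`-th coordinate is matched or exceeded by another coordinate, but by no
more than `Δ`. -/
def nearMaxOvertaken {K : ℕ} (Δ : ℝ) (k : Fin K) : Set (Fin K → ℝ) :=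
  {x | (∃ j, j ≠ k ∧ x k ≤ x j) ∧ ∀ j, j ≠ k → x j - Δ ≤ x k}

lemma measurableSet_nearMaxOvertaken {K : ℕ} (Δ : ℝ) (k : Fin K) :
    MeasurableSet (nearMaxOvertaken Δ k) := by
  have h1 (j : Fin K) : MeasurableSet {x : Fin K → ℝ | x k ≤ x j} :=
    measurableSet_le (by fun_prop) (by fun_prop)
  have h2 (j : Fin K) : MeasurableSet {x : Fin K → ℝ | x j - Δ ≤ x k} :=
    measurableSet_le (by fun_prop) (by fun_prop)
  have h3 : MeasurableSet {x : Fin K → ℝ | ∃ j, j ≠ k ∧ x k ≤ x j} := by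
    simp only [Set.ofPred_exists]
    exact .iUnion fun j => (MeasurableSet.const _).inter (h1 j)
  have h4 : MeasurableSet {x : Fin K → ℝ | ∀ j, j ≠ k → x j - Δ ≤ x k} := by
    simp only [Set.ofPred_forall]
    exact .iInter fun j => .iInter fun _ => h2 j
  exact h3.inter h4

lemma pi_gaussianReal_nearMaxOvertaken_le {n : ℕ} (Δ : ℝ) (k : Fin (n + 1)) :
    (Measure.pi fun _ : Fin (n + 1) => gaussianReal 0 1) (nearMaxOvertaken Δ k)
      ≤ ENNReal.ofReal (Δ / √(2 * π)) := by
  have hmp := (measurePreserving_piFinSuccAbove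
    (fun _ : Fin (n + 1) => gaussianReal 0 1) k).symm
  rw [← hmp.measure_preimage (measurableSet_nearMaxOvertaken Δ k).nullMeasurableSet,
    Measure.prod_apply_symm (hmp.measurable (measurableSet_nearMaxOvertaken Δ k))]
  refine (lintegral_mono (g := fun _ => ENNReal.ofReal (Δ / √(2 * π))) fun y => ?_).trans
    (by simp)
  rcases isEmpty_or_nonempty (Fin n) with hn | hn
  · refine (measure_mono_null (t := ∅) ?_ measure_empty).trans_le zero_le
    rintro t ⟨⟨j, hj, -⟩, -⟩
    obtain ⟨i, -⟩ := Fin.exists_succAbove_eq hj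
    exact hn.elim i
  · obtain ⟨i, hi⟩ := Finite.exists_max y
    refine (measure_mono ?_).trans (gaussianReal_Icc_sub_le (y i) Δ)
    rintro t ⟨⟨j, hj, hle⟩, hall⟩
    obtain ⟨l, rfl⟩ := Fin.exists_succAbove_eq hj
    have hi' := hall (k.succAbove i) (Fin.succAbove_ne k i)
    have he : (MeasurableEquiv.piFinSuccAbove (fun _ => ℝ) k).symm (t, y)
        = k.insertNth (α := fun _ => ℝ) t y := rfl
    simp only [he, Fin.insertNth_apply_same, Fin.insertNth_apply_succAbove] at hle hi'
    exact ⟨by linarith, hle.trans (hi l)⟩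

/-- All near-maximal coordinates except one chosen maximiser are overtaken by that maximiser. -/
lemma card_nearMax_le {K : ℕ} [NeZero K] (Δ : ℝ) (x : Fin K → ℝ) :
    (Nat.card {k : Fin K // (⨆ j, x j) - Δ ≤ x k} : ℝ)
      ≤ 1 + ∑ k, (nearMaxOvertaken Δ k).indicator (fun _ => (1 : ℝ)) x := by
  classical
  obtain ⟨m, hm⟩ := Finite.exists_max x
  have hle (j : Fin K) : x j ≤ ⨆ i, x i := le_ciSup (Set.finite_range x).bddAbove j
  have hsub : (Finset.univ.filter fun k => (⨆ j, x j) - Δ ≤ x k)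
      ⊆ insert m (Finset.univ.filter fun k => x ∈ nearMaxOvertaken Δ k) := by
    intro k hk
    simp only [Finset.mem_filter, Finset.mem_univ, true_and, Finset.mem_insert] at hk ⊢
    by_cases hkm : k = m
    · exact .inl hkm
    · exact .inr ⟨⟨m, Ne.symm hkm, hm k⟩, fun j _ => by linarith [hle j]⟩
  have hcard := (Finset.card_le_card hsub).trans (Finset.card_insert_le _ _)
  rw [Nat.card_eq_fintype_card, Fintype.card_subtype]
  simp only [Set.indicator_apply, Finset.sum_boole]
  rw [add_comm]
  exact_mod_cast hcard

/-- If `θ_1, ..., θ_K` (with `K ≥ 1`) are i.i.d. standard Gaussian and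
`Δ ≥ 0`, then the expected number of coordinates within `Δ` of the maximum satisfies
`E[|{k : θ_k ≥ max_j θ_j − Δ}|] ≤ 1 + KΔ/√(2π)`. -/
theorem expected_card_near_max_iid_gaussian
    (K : ℕ) (hK : 1 ≤ K) [NeZero K] (Δ : ℝ) (hΔ : 0 ≤ Δ)
    (Ω : Type) [MeasureSpace Ω] [IsProbabilityMeasure (ℙ : Measure Ω)]
    (θ : Ω → Fin K → ℝ) (hθmeas : Measurable θ)
    (hlaw : Measure.map θ ℙ = Measure.pi fun _ : Fin K => gaussianReal 0 1) :
    ∫ ω, (Nat.card {k : Fin K // (⨆ j, θ ω j) - Δ ≤ θ ω k} : ℝ) ∂ℙ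
      ≤ 1 + K * Δ / Real.sqrt (2 * π) := by
  have hmeas (k : Fin K) : MeasurableSet (θ ⁻¹' nearMaxOvertaken Δ k) :=
    hθmeas (measurableSet_nearMaxOvertaken Δ k)
  have hint (k : Fin K) :
      Integrable ((θ ⁻¹' nearMaxOvertaken Δ k).indicator fun _ => (1 : ℝ)) ℙ :=
    (integrable_const 1).indicator (hmeas k)
  have hprob (k : Fin K) :
      (ℙ : Measure Ω).real (θ ⁻¹' nearMaxOvertaken Δ k) ≤ Δ / √(2 * π) := by
    refine ENNReal.toReal_le_of_le_ofReal (by positivity) ?_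
    rw [← Measure.map_apply hθmeas (measurableSet_nearMaxOvertaken Δ k), hlaw]
    obtain ⟨n, rfl⟩ := Nat.exists_eq_add_of_le' hK
    exact pi_gaussianReal_nearMaxOvertaken_le Δ k
  calc ∫ ω, (Nat.card {k : Fin K // (⨆ j, θ ω j) - Δ ≤ θ ω k} : ℝ) ∂ℙ
      ≤ ∫ ω, (1 + ∑ k, (θ ⁻¹' nearMaxOvertaken Δ k).indicator (fun _ => (1 : ℝ)) ω) ∂ℙ :=
        integral_mono_of_nonneg (.of_forall fun ω => Nat.cast_nonneg _)
          ((integrable_const 1).add (integrable_finsetSum _ fun k _ => hint k))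
          (.of_forall fun ω => card_nearMax_le Δ (θ ω))
    _ = 1 + ∑ k, (ℙ : Measure Ω).real (θ ⁻¹' nearMaxOvertaken Δ k) := by
        rw [integral_add (integrable_const 1) (integrable_finsetSum _ fun k _ => hint k),
          integral_finsetSum _ fun k _ => hint k]
        simp [integral_indicator_const, hmeas]
    _ ≤ 1 + ∑ _ : Fin K, Δ / √(2 * π) := by
        gcongr with k
        exact hprob k
    _ = 1 + K * Δ / √(2 * π) := by
        simp [mul_div_assoc]
end
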